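/- arXiv:1611.02743 — 3 statements merged into one kernel-verified Lean document; each statement's English description precedes it below -/
import Mathlib

section
/- Let A₁, A₂ ∈ SL(2,ℂ) with tr A₁, tr A₂ and tr(A₁A₂) all real, let (A₁,A₂) be elementwise-periodic, and suppose E(χ(id)) ≠ 1 and χ(id) does not lie on a coordinate axis of ℝ³ (i.e. no two of its three coordinates are both zero). Then A₂ has finite order in SL(2,ℂ), and moreover for every automorphism α of F₂ the matrix ρ(α(a₂)) has finite order. -/
open Matrix

noncomputable section

abbrev SL2C := Matrix.SpecialLinearGroup (Fin 2) ℂ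

/-- The representation `F₂ → SL(2,ℂ)` sending `a₁ ↦ A₁`, `a₂ ↦ A₂`. -/
def rho (A₁ A₂ : SL2C) : FreeGroup (Fin 2) →* SL2C := FreeGroup.lift ![A₁, A₂]

/-- `χ(α) = (tr ρ(α a₁)/2, tr ρ(α a₂)/2, tr ρ(α (a₁a₂))/2)`. -/
def chi (A₁ A₂ : SL2C) (α : MulAut (FreeGroup (Fin 2))) : ℂ × ℂ × ℂ :=
  ( Matrix.trace ((rho A₁ A₂ (α (FreeGroup.of 0)) : Matrix (Fin 2) (Fin 2) ℂ)) / 2,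
    Matrix.trace ((rho A₁ A₂ (α (FreeGroup.of 1)) : Matrix (Fin 2) (Fin 2) ℂ)) / 2,
    Matrix.trace ((rho A₁ A₂ (α (FreeGroup.of 0 * FreeGroup.of 1)) : Matrix (Fin 2) (Fin 2) ℂ)) / 2 )

/-- `(A₁,A₂)` is elementwise-periodic. -/
def ElemPeriodic (A₁ A₂ : SL2C) : Prop :=
  ∀ α : MulAut (FreeGroup (Fin 2)), (Set.range fun k : ℕ => chi A₁ A₂ (α ^ k)).Finite

/-- `E(x,y,z) = x² + y² + z² − 2xyz`. -/
def E (x y z : ℂ) : ℂ := x ^ 2 + y ^ 2 + z ^ 2 - 2 * x * y * z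

namespace Aux

abbrev M2 := Matrix (Fin 2) (Fin 2) ℂ

lemma ch (X : M2) : X * X = X.trace • X - X.det • (1 : M2) := by
  ext i j
  fin_cases i <;> fin_cases j <;>
    simp [Matrix.mul_apply, Fin.sum_univ_two, Matrix.trace, Matrix.det_fin_two] <;> ring

lemma anti (X Y : M2) : Y * X = X.trace • Y + Y.trace • X
    + ((X * Y).trace - X.trace * Y.trace) • (1 : M2) - X * Y := by
  ext i j
  fin_cases i <;> fin_cases j <;>
    simp [Matrix.mul_apply, Fin.sum_univ_two, Matrix.trace] <;> ring

lemma det_comm (X Y : M2) : (X * Y - Y * X).det =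
    4 * X.det * Y.det - Y.det * X.trace ^ 2 - X.det * Y.trace ^ 2 - (X * Y).trace ^ 2
      + X.trace * Y.trace * (X * Y).trace := by
  simp [Matrix.mul_apply, Fin.sum_univ_two, Matrix.trace, Matrix.det_fin_two]
  ring

lemma comm_mul (X Y : M2) : (X * Y - Y * X) * Y = (Y.trace • (1 : M2) - Y) * (X * Y - Y * X) := by
  ext i j
  fin_cases i <;> fin_cases j <;>
    simp [Matrix.mul_apply, Fin.sum_univ_two, Matrix.trace, Matrix.one_apply] <;> ring

lemma comm_comb (X Y : M2) (p q r s p' q' r' s' : ℂ) :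
    (p • (1 : M2) + q • X + r • Y + s • (X * Y)) * (p' • (1 : M2) + q' • X + r' • Y + s' • (X * Y))
    - (p' • (1 : M2) + q' • X + r' • Y + s' • (X * Y)) * (p • (1 : M2) + q • X + r • Y + s • (X * Y))
    = ((q * r' - r * q') • (1 : M2) + (q * s' - s * q') • X
        - (r * s' - s * r') • (Y.trace • (1 : M2) - Y)) * (X * Y - Y * X) := by
  have : ((q * r' - r * q') • (1 : M2) + (q * s' - s * q') • X
        - (r * s' - s * r') • (Y.trace • (1 : M2) - Y)) * (X * Y - Y * X)
      = (q * r' - r * q') • (X * Y - Y * X) + (q * s' - s * q') • (X * (X * Y - Y * X))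
        - (r * s' - s * r') • ((X * Y - Y * X) * Y) := by
    rw [comm_mul]; simp only [add_mul, sub_mul, smul_mul_assoc, one_mul]
  rw [this]
  simp only [add_mul, mul_add, sub_mul, mul_sub, smul_mul_assoc, mul_smul_comm, one_mul, mul_one,
    mul_assoc]
  module

/-- matrix valued functions of the pair expressible in the basis with trace coefficients -/
def Good (F : SL2C → SL2C → M2) : Prop :=
  ∃ p q r s : ℂ × ℂ × ℂ → ℂ, ∀ X Y : SL2C, ∀ c : ℂ × ℂ × ℂ,
    c = ((X : M2).trace, (Y : M2).trace, ((X : M2) * (Y : M2)).trace) →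
    F X Y = p c • (1 : M2) + q c • (X : M2) + r c • (Y : M2) + s c • ((X : M2) * (Y : M2))

lemma Good.add {F G} (hF : Good F) (hG : Good G) : Good (fun X Y => F X Y + G X Y) := by
  obtain ⟨p, q, r, s, h⟩ := hF
  obtain ⟨p', q', r', s', h'⟩ := hG
  refine ⟨p + p', q + q', r + r', s + s', fun X Y c hc => ?_⟩
  simp only [h X Y c hc, h' X Y c hc, Pi.add_apply]
  module

lemma Good.smul {F} (f : ℂ × ℂ × ℂ → ℂ) (hF : Good F) :
    Good (fun X Y => f ((X : M2).trace, (Y : M2).trace, ((X : M2) * (Y : M2)).trace) • F X Y) := by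
  obtain ⟨p, q, r, s, h⟩ := hF
  refine ⟨f * p, f * q, f * r, f * s, fun X Y c hc => ?_⟩
  simp only [h X Y c hc, Pi.mul_apply, ← hc]
  module

lemma Good.one : Good (fun _ _ => 1) := ⟨1, 0, 0, 0, fun X Y c hc => by simp⟩
lemma Good.X : Good (fun X _ => (X : M2)) := ⟨0, 1, 0, 0, fun X Y c hc => by simp⟩
lemma Good.Y : Good (fun _ Y => (Y : M2)) := ⟨0, 0, 1, 0, fun X Y c hc => by simp⟩

lemma Good.mulX {F} (hF : Good F) : Good (fun X Y => (X : M2) * F X Y) := by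
  obtain ⟨p, q, r, s, h⟩ := hF
  refine ⟨fun c => - q c, fun c => p c + c.1 * q c, fun c => - s c, fun c => r c + c.1 * s c,
    fun X Y c hc => ?_⟩
  have h1 : (X : M2) * X = (X : M2).trace • (X : M2) - (1 : M2) := by
    rw [ch (X : M2)]; simp
  have h2 : (X : M2) * ((X : M2) * Y) = (X : M2).trace • ((X : M2) * Y) - (Y : M2) := by
    rw [← mul_assoc, h1]; simp [sub_mul]
  simp only [h X Y c hc, mul_add, mul_smul_comm, mul_one, h1, h2]
  subst hc
  module

lemma Good.mulY {F} (hF : Good F) : Good (fun X Y => (Y : M2) * F X Y) := by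
  obtain ⟨p, q, r, s, h⟩ := hF
  have hr : Good (fun X Y => (Y : M2) * (X : M2)) := by
    refine ⟨fun c => c.2.2 - c.1 * c.2.1, fun c => c.2.1, fun c => c.1, fun c => -1,
      fun X Y c hc => ?_⟩
    subst hc
    have e := anti (X : M2) (Y : M2)
    dsimp only
    rw [e]; module
  have hyy : Good (fun X Y => (Y : M2) * (Y : M2)) := by
    refine ⟨fun c => -1, fun c => 0, fun c => c.2.1, fun c => 0, fun X Y c hc => ?_⟩
    subst hc
    have h1 : (Y : M2) * Y = (Y : M2).trace • (Y : M2) - (1 : M2) := by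
      rw [ch (Y : M2)]; simp
    dsimp only
    rw [h1]; module
  have hyxy : Good (fun X Y => (Y : M2) * ((X : M2) * (Y : M2))) := by
    refine ⟨fun c => - c.1 , fun c => 1, fun c => c.2.2, fun c => 0,
      fun X Y c hc => ?_⟩
    subst hc
    have e := anti (X : M2) (Y : M2)
    have h1 : (Y : M2) * Y = (Y : M2).trace • (Y : M2) - (1 : M2) := by
      rw [ch (Y : M2)]; simp
    dsimp only
    rw [← mul_assoc, e]
    simp only [sub_mul, add_mul, smul_mul_assoc, mul_assoc, h1, mul_sub, mul_smul_comm, mul_one,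
      one_mul]
    module
  have := (((Good.Y.smul p).add (hr.smul q)).add (hyy.smul r)).add (hyxy.smul s)
  obtain ⟨p', q', r', s', h'⟩ := this
  refine ⟨p', q', r', s', fun X Y c hc => ?_⟩
  rw [← h' X Y c hc]
  simp only [h X Y c hc, mul_add, mul_smul_comm, mul_one, ← hc]

lemma Good.mul {F G} (hF : Good F) (hG : Good G) : Good (fun X Y => F X Y * G X Y) := by
  obtain ⟨p, q, r, s, h⟩ := hF
  have := (((hG.smul p).add (hG.mulX.smul q)).add (hG.mulY.smul r)).add (hG.mulY.mulX.smul s)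
  obtain ⟨p', q', r', s', h'⟩ := this
  refine ⟨p', q', r', s', fun X Y c hc => ?_⟩
  rw [← h' X Y c hc]
  simp only [h X Y c hc, add_mul, smul_mul_assoc, one_mul, ← hc, mul_assoc]

lemma inv_eq (X : SL2C) : ((X⁻¹ : SL2C) : M2) = (X : M2).trace • (1 : M2) - (X : M2) := by
  rw [Matrix.SpecialLinearGroup.coe_inv]
  ext i j
  fin_cases i <;> fin_cases j <;> simp [Matrix.adjugate_fin_two, Matrix.trace]

lemma adj_eq (X : M2) : X.adjugate = X.trace • (1 : M2) - X := by
  ext i j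
  fin_cases i <;> fin_cases j <;> simp [Matrix.adjugate_fin_two, Matrix.trace]

lemma rho0 (X Y : SL2C) : rho X Y (FreeGroup.of 0) = X := by simp [rho]
lemma rho1 (X Y : SL2C) : rho X Y (FreeGroup.of 1) = Y := by simp [rho]

lemma good_word (w : FreeGroup (Fin 2)) : Good (fun X Y => (rho X Y w : M2)) := by
  induction w using FreeGroup.induction_on with
  | C1 => simpa using Good.one
  | of i =>
    fin_cases i
    · simpa [rho0] using Good.X
    · simpa [rho1] using Good.Y
  | inv_of i _ =>
    fin_cases i
    · obtain ⟨p, q, r, s, h⟩ := (Good.one.smul (fun c => c.1)).add (Good.X.smul (fun c => -1))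
      refine ⟨p, q, r, s, fun X Y c hc => ?_⟩
      rw [← h X Y c hc]
      simp [rho0, adj_eq, sub_eq_add_neg]
    · obtain ⟨p, q, r, s, h⟩ := (Good.one.smul (fun c => c.2.1)).add (Good.Y.smul (fun c => -1))
      refine ⟨p, q, r, s, fun X Y c hc => ?_⟩
      rw [← h X Y c hc]
      simp [rho1, adj_eq, sub_eq_add_neg]
  | mul x y hx hy => simpa using hx.mul hy

lemma trace_word (w : FreeGroup (Fin 2)) : ∃ f : ℂ × ℂ × ℂ → ℂ, ∀ X Y : SL2C,
    (rho X Y w : M2).trace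
      = f ((X : M2).trace / 2, (Y : M2).trace / 2, ((X * Y : SL2C) : M2).trace / 2) := by
  obtain ⟨p, q, r, s, h⟩ := good_word w
  dsimp only at h
  let g : ℂ × ℂ × ℂ → ℂ := fun c => p c * 2 + q c * c.1 + r c * c.2.1 + s c * c.2.2
  refine ⟨fun c => g (c.1 * 2, c.2.1 * 2, c.2.2 * 2), fun X Y => ?_⟩
  rw [h X Y _ rfl]
  simp [g, Matrix.trace_add, Matrix.trace_smul]

lemma det_words (X Y : SL2C) (h : ((X : M2) * Y - Y * X).det = 0) (w w' : FreeGroup (Fin 2)) :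
    ((rho X Y w : M2) * (rho X Y w') - (rho X Y w') * (rho X Y w)).det = 0 := by
  obtain ⟨p, q, r, s, h1⟩ := good_word w
  obtain ⟨p', q', r', s', h2⟩ := good_word w'
  dsimp only at h1 h2
  rw [h1 X Y _ rfl, h2 X Y _ rfl, comm_comb, Matrix.det_mul, h, mul_zero]

/-- parity -/
def par (u : Fin 2 → ZMod 2) : FreeGroup (Fin 2) →* Multiplicative (ZMod 2) :=
  FreeGroup.lift (fun i => Multiplicative.ofAdd (u i))

lemma dihedral (X Y : SL2C) (hx : (X : M2).trace = 0) (hxy : ((X : M2) * Y).trace = 0)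
    (w : FreeGroup (Fin 2)) :
    (par ![1, 0] w = 1 ∧ ∃ p q : ℂ, (rho X Y w : M2) = p • (1 : M2) + q • (Y : M2)) ∨
    (par ![1, 0] w = Multiplicative.ofAdd 1 ∧
      ∃ p q : ℂ, (rho X Y w : M2) = p • (X : M2) + q • ((X : M2) * Y)) := by
  have hxx : (X : M2) * X = - (1 : M2) := by rw [ch (X : M2)]; simp [hx]
  have hyy : (Y : M2) * Y = (Y : M2).trace • (Y : M2) - (1 : M2) := by rw [ch (Y : M2)]; simp
  have hyx : (Y : M2) * X = (Y : M2).trace • (X : M2) - (X : M2) * Y := by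
    rw [anti]; simp [hx, hxy]
  have hyx' : ∀ Z : M2, (Y : M2) * (X * Z) = (Y : M2).trace • ((X : M2) * Z) - (X : M2) * (Y * Z) := by
    intro Z
    rw [← mul_assoc, hyx, sub_mul, smul_mul_assoc, mul_assoc]
  have hxx' : ∀ Z : M2, (X : M2) * (X * Z) = - Z := by
    intro Z
    rw [← mul_assoc, hxx, neg_one_mul]
  induction w using FreeGroup.induction_on with
  | C1 => exact Or.inl ⟨by simp, 1, 0, by simp⟩
  | of i =>
    fin_cases i
    · exact Or.inr ⟨by simp [par], 1, 0, by simp [rho0]⟩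
    · exact Or.inl ⟨by simp [par], 0, 1, by simp [rho1]⟩
  | inv_of i _ =>
    fin_cases i
    · exact Or.inr ⟨by simp [par]; decide, -1, 0, by simp [rho0, adj_eq, hx]⟩
    · exact Or.inl ⟨by simp [par], (Y : M2).trace, -1, by simp [rho1, adj_eq]; module⟩
  | mul x y hx hy =>
    rw [map_mul, map_mul, Matrix.SpecialLinearGroup.coe_mul]
    rcases hx with ⟨h1, p, q, h2⟩ | ⟨h1, p, q, h2⟩ <;>
    rcases hy with ⟨h3, p', q', h4⟩ | ⟨h3, p', q', h4⟩ <;> rw [h1, h2, h3, h4]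
    · refine Or.inl ⟨by simp, p * p' - q * q', p * q' + q * p' + q * q' * (Y : M2).trace, ?_⟩
      simp only [add_mul, mul_add, smul_mul_assoc, mul_smul_comm, one_mul, mul_one, hyy]
      module
    · refine Or.inr ⟨by simp, p * p' + q * p' * (Y : M2).trace + q * q',
        p * q' - q * p', ?_⟩
      simp only [add_mul, mul_add, smul_mul_assoc, mul_smul_comm, one_mul, mul_one, hyy, hyx,
        hyx', mul_sub]
      module
    · refine Or.inr ⟨by simp, p * p' - q * q', p * q' + q * p' + q * q' * (Y : M2).trace, ?_⟩
      simp only [add_mul, mul_add, smul_mul_assoc, mul_smul_comm, one_mul, mul_one, hyy, mul_assoc,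
        mul_sub]
      module
    · refine Or.inl ⟨by decide, - p * p' - q * p' * (Y : M2).trace - q * q',
        - p * q' + q * p', ?_⟩
      simp only [add_mul, mul_add, smul_mul_assoc, mul_smul_comm, one_mul, mul_one, hyy, hyx,
        hyx', hxx, hxx', mul_sub, mul_assoc]
      module

lemma dihedral_trace (X Y : SL2C) (hx : (X : M2).trace = 0) (hxy : ((X : M2) * Y).trace = 0)
    (w : FreeGroup (Fin 2)) (hw : par ![1, 0] w ≠ 1) : (rho X Y w : M2).trace = 0 := by
  rcases dihedral X Y hx hxy w with ⟨h1, _⟩ | ⟨_, p, q, h2⟩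
  · exact absurd h1 hw
  · rw [h2]; simp [hx, hxy]

lemma basis_par (β : MulAut (FreeGroup (Fin 2))) (φ : FreeGroup (Fin 2) →* Multiplicative (ZMod 2))
    (h0 : φ (β (FreeGroup.of 0)) = 1) (h1 : φ (β (FreeGroup.of 1)) = 1) : φ = 1 := by
  have : φ.comp β.toMonoidHom = 1 := by
    ext i
    fin_cases i
    · simpa using h0
    · simpa using h1
  ext i
  have := DFunLike.congr_fun this (β⁻¹ (FreeGroup.of i))
  simpa using this

lemma zm (a : Multiplicative (ZMod 2)) : a = 1 ∨ a = Multiplicative.ofAdd 1 := by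
  revert a; decide

lemma finOrder (A B : SL2C)
    (hfin : (Set.range fun k : ℕ => ((A * B ^ k : SL2C) : M2).trace).Finite)
    (hax : ¬ ((A : M2).trace = 0 ∧ ((A : M2) * B).trace = 0))
    (hdet : ((A : M2) * B - B * A).det ≠ 0) : IsOfFinOrder B := by
  set x : ℕ → ℂ := fun k => ((A * B ^ k : SL2C) : M2).trace with hxdef
  set t := (B : M2).trace with ht
  have hBB : (B : M2) * B = t • (B : M2) - (1 : M2) := by rw [ch (B : M2)]; simp [ht]
  have hx0 : x 0 = (A : M2).trace := by simp [hxdef]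
  have hx1 : x 1 = ((A : M2) * B).trace := by simp [hxdef]
  have hrec : ∀ k, x (k + 2) = t * x (k + 1) - x k := by
    intro k
    have : (A : M2) * (B : M2) ^ (k + 2) = t • ((A : M2) * (B : M2) ^ (k + 1)) - (A : M2) * (B : M2) ^ k := by
      rw [pow_add, pow_two, hBB, pow_succ]
      simp [mul_sub]
    simp only [hxdef, Matrix.SpecialLinearGroup.coe_mul, Matrix.SpecialLinearGroup.coe_pow, this]
    simp
  obtain ⟨i, j, hij, hxi, hxj⟩ : ∃ i j : ℕ, i < j ∧ x i = x j ∧ x (i + 1) = x (j + 1) := by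
    have hf : (Set.range fun k : ℕ => (x k, x (k + 1))).Finite := by
      refine (hfin.prod hfin).subset ?_
      rintro _ ⟨k, rfl⟩
      exact ⟨⟨k, rfl⟩, ⟨k + 1, rfl⟩⟩
    have hni : ¬ Function.Injective (fun k : ℕ => (x k, x (k + 1))) := fun hinj =>
      Set.infinite_range_of_injective hinj hf
    simp only [Function.Injective, not_forall] at hni
    obtain ⟨a, b, hab, hne⟩ := hni
    simp only [Prod.mk.injEq] at hab
    rcases lt_or_gt_of_ne hne with h | h
    · exact ⟨a, b, h, hab.1, hab.2⟩
    · exact ⟨b, a, h, hab.1.symm, hab.2.symm⟩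
  obtain ⟨l, hl⟩ : ∃ l : ℂ, l ^ 2 - t * l + 1 = 0 := by
    obtain ⟨d, hd⟩ := IsAlgClosed.exists_pow_nat_eq (t ^ 2 - 4) (n := 2) (by norm_num)
    exact ⟨(t + d) / 2, by linear_combination hd / 4⟩
  have hl0 : l ≠ 0 := by rintro rfl; simp at hl
  obtain ⟨m, hm⟩ : ∃ m : ℂ, m = l⁻¹ := ⟨_, rfl⟩
  have hlm : l * m = 1 := by rw [hm]; exact mul_inv_cancel₀ hl0
  have hm0 : m ≠ 0 := by rw [hm]; exact inv_ne_zero hl0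
  have htm : t = l + m := by
    have : l * (t - l - m) = 0 := by linear_combination -hl - hlm
    have := (mul_eq_zero.mp this).resolve_left hl0
    linear_combination this
  have hu : ∀ k, x (k + 1) - m * x k = l ^ k * (x 1 - m * x 0) := by
    intro k
    induction k with
    | zero => simp
    | succ k ih =>
      rw [hrec, pow_succ, htm]; linear_combination l * ih + x k * hlm
  have hv : ∀ k, x (k + 1) - l * x k = m ^ k * (x 1 - l * x 0) := by
    intro k
    induction k with
    | zero => simp
    | succ k ih =>
      rw [hrec, pow_succ, htm]; linear_combination m * ih + x k * hlm
  have hpow : ∀ c : ℂ, c ≠ 0 → c ^ i = c ^ j → c ^ (j - i) = 1 := by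
    intro c hc h
    have : c ^ j = c ^ i * c ^ (j - i) := by rw [← pow_add]; congr 1; omega
    rw [← h] at this
    exact (mul_eq_left₀ (pow_ne_zero _ hc)).mp this.symm
  by_cases hlm' : l = m
  · skip
    exfalso
    subst hlm'
    have hu0 : x 1 - l * x 0 = 0 := by
      by_contra hne
      have e : l ^ i = l ^ j := by
        have := hu i
        rw [hxi, hxj, hu j] at this
        exact (mul_right_cancel₀ hne this).symm
      have hy : ∀ k : ℕ, l ^ k * x k = x 0 + k * (l * (x 1 - l * x 0)) := by
        intro k
        induction k with
        | zero => simp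
        | succ k ih =>
          have h2 : l ^ k * l ^ k = 1 := by rw [← mul_pow, hlm, one_pow]
          have := hu k
          push_cast
          rw [pow_succ]
          linear_combination ih + l ^ k * l * this + l * (x 1 - l * x 0) * h2 + l ^ k * x k * hlm
      have h1 := hy i
      rw [e, hxi, hy j] at h1
      have h3 : ((j : ℂ) - i) * (l * (x 1 - l * x 0)) = 0 := by linear_combination h1
      rcases mul_eq_zero.mp h3 with h | h
      · have : (j : ℂ) = i := by linear_combination h
        have : j = i := by exact_mod_cast this
        omega
      · exact (mul_ne_zero hl0 hne) h
    apply hdet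
    rw [det_comm]
    have e1 : ((A : M2) * B).trace = l * (A : M2).trace := by
      rw [← hx1, ← hx0]; linear_combination hu0
    rw [e1, ← ht, htm]
    simp only [Matrix.SpecialLinearGroup.det_coe]
    linear_combination (-4 + (A : M2).trace ^ 2) * hlm
  · have hln : l ^ (j - i) = 1 := by
      by_cases hu0 : x 1 - m * x 0 = 0
      · by_cases hv0 : x 1 - l * x 0 = 0
        · exfalso
          have h0 : x 0 = 0 := by
            have : (l - m) * x 0 = 0 := by linear_combination hu0 - hv0
            exact (mul_eq_zero.mp this).resolve_left (sub_ne_zero.mpr hlm')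
          exact hax ⟨by rw [← hx0, h0], by rw [← hx1]; linear_combination hu0 + m * h0⟩
        · have e : m ^ i = m ^ j := by
            have := hv i
            rw [hxi, hxj, hv j] at this
            exact (mul_right_cancel₀ hv0 this).symm
          have := hpow m hm0 e
          rw [hm, inv_pow, inv_eq_one] at this
          exact this
      · have e : l ^ i = l ^ j := by
          have := hu i
          rw [hxi, hxj, hu j] at this
          exact (mul_right_cancel₀ hu0 this).symm
        exact hpow l hl0 e
    have hmn : m ^ (j - i) = 1 := by rw [hm, inv_pow, hln, inv_one]
    have hB1 : ∀ k : ℕ, (B : M2) ^ k * ((B : M2) - l • (1 : M2)) = m ^ k • ((B : M2) - l • (1 : M2)) := by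
      intro k
      induction k with
      | zero => simp
      | succ k ih =>
        have : (B : M2) * ((B : M2) - l • (1 : M2)) = m • ((B : M2) - l • (1 : M2)) := by
          rw [mul_sub, hBB, htm, smul_sub, smul_smul, mul_comm m l, hlm, mul_smul_comm, mul_one]
          module
        rw [pow_succ, mul_assoc, this, mul_smul_comm, ih, smul_smul, pow_succ, mul_comm]
    have hB2 : ∀ k : ℕ, (B : M2) ^ k * ((B : M2) - m • (1 : M2)) = l ^ k • ((B : M2) - m • (1 : M2)) := by
      intro k
      induction k with
      | zero => simp
      | succ k ih =>
        have : (B : M2) * ((B : M2) - m • (1 : M2)) = l • ((B : M2) - m • (1 : M2)) := by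
          rw [mul_sub, hBB, htm, smul_sub, smul_smul, hlm, mul_smul_comm, mul_one]
          module
        rw [pow_succ, mul_assoc, this, mul_smul_comm, ih, smul_smul, pow_succ, mul_comm]
    have e1 := hB1 (j - i)
    have e2 := hB2 (j - i)
    rw [hmn, one_smul, mul_sub, mul_smul_comm, mul_one] at e1
    rw [hln, one_smul, mul_sub, mul_smul_comm, mul_one] at e2
    have e3 : (l - m) • ((B : M2) ^ (j - i)) = (l - m) • (1 : M2) := by
      have : (l - m) • ((B : M2) ^ (j - i)) - (l - m) • (1 : M2) =
        ((B : M2) ^ (j - i) * B - m • (B : M2) ^ (j - i)) - ((B : M2) ^ (j - i) * B - l • (B : M2) ^ (j - i))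
          - (l - m) • (1 : M2) := by module
      rw [← sub_eq_zero, this, e1, e2]; module
    have e4 : (B : M2) ^ (j - i) = 1 := smul_right_injective M2 (sub_ne_zero.mpr hlm') e3
    rw [isOfFinOrder_iff_pow_eq_one]
    refine ⟨j - i, by omega, ?_⟩
    apply Subtype.ext
    simpa using e4

/-- Dehn twist -/
def tw : MulAut (FreeGroup (Fin 2)) :=
  MonoidHom.toMulEquiv
    (FreeGroup.lift ![FreeGroup.of 0 * FreeGroup.of 1, FreeGroup.of 1])
    (FreeGroup.lift ![FreeGroup.of 0 * (FreeGroup.of 1)⁻¹, FreeGroup.of 1])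
    (by ext i; fin_cases i <;> simp) (by ext i; fin_cases i <;> simp)

lemma tw0 : tw (FreeGroup.of 0) = FreeGroup.of 0 * FreeGroup.of 1 := by simp [tw]
lemma tw1 : tw (FreeGroup.of 1) = FreeGroup.of 1 := by simp [tw]

lemma tw_pow (k : ℕ) : (tw ^ k) (FreeGroup.of 0) = FreeGroup.of 0 * FreeGroup.of 1 ^ k := by
  induction k with
  | zero => simp
  | succ k ih =>
    rw [pow_succ', MulAut.mul_apply, ih, map_mul, map_pow, tw0, tw1, pow_succ', mul_assoc]

lemma rho_comp (A₁ A₂ : SL2C) (α : MulAut (FreeGroup (Fin 2))) (w : FreeGroup (Fin 2)) :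
    rho (rho A₁ A₂ (α (FreeGroup.of 0))) (rho A₁ A₂ (α (FreeGroup.of 1))) w = rho A₁ A₂ (α w) := by
  have : rho (rho A₁ A₂ (α (FreeGroup.of 0))) (rho A₁ A₂ (α (FreeGroup.of 1)))
      = (rho A₁ A₂).comp α.toMonoidHom := by
    ext1 i
    fin_cases i
    · simp [rho0]
    · simp [rho1]
  rw [this]; rfl

lemma main (A₁ A₂ : SL2C) (hper : ElemPeriodic A₁ A₂)
    (hE : E (chi A₁ A₂ 1).1 (chi A₁ A₂ 1).2.1 (chi A₁ A₂ 1).2.2 ≠ 1)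
    (haxis : ¬ (((chi A₁ A₂ 1).1 = 0 ∧ (chi A₁ A₂ 1).2.1 = 0) ∨
                ((chi A₁ A₂ 1).1 = 0 ∧ (chi A₁ A₂ 1).2.2 = 0) ∨
                ((chi A₁ A₂ 1).2.1 = 0 ∧ (chi A₁ A₂ 1).2.2 = 0)))
    (α : MulAut (FreeGroup (Fin 2))) : IsOfFinOrder (rho A₁ A₂ (α (FreeGroup.of 1))) := by
  have hA : ∀ w, rho (rho A₁ A₂ (α (FreeGroup.of 0))) (rho A₁ A₂ (α (FreeGroup.of 1))) (α⁻¹ w)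
      = rho A₁ A₂ w := by
    intro w; rw [rho_comp]; simp
  simp only [chi, MulAut.one_apply, rho0, rho1, map_mul, div_eq_zero_iff, OfNat.ofNat_ne_zero,
    or_false] at hE haxis
  apply finOrder (rho A₁ A₂ (α (FreeGroup.of 0)))
  · obtain ⟨f, hf⟩ := trace_word (α (FreeGroup.of 0))
    refine ((hper (α * tw * α⁻¹)).image f).subset ?_
    rintro _ ⟨k, rfl⟩
    refine ⟨_, ⟨k, rfl⟩, ?_⟩
    have := hf (rho A₁ A₂ (((α * tw * α⁻¹) ^ k) (FreeGroup.of 0)))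
      (rho A₁ A₂ (((α * tw * α⁻¹) ^ k) (FreeGroup.of 1)))
    rw [rho_comp] at this
    simp only [chi, map_mul] at this ⊢
    rw [← this, conj_pow]
    simp [tw_pow]
  · rintro ⟨h1, h2⟩
    have key := fun w => dihedral_trace _ _ h1 h2 (α⁻¹ w)
    simp only [hA] at key
    have k0 := key (FreeGroup.of 0)
    have k1 := key (FreeGroup.of 1)
    have k2 := key (FreeGroup.of 0 * FreeGroup.of 1)
    rw [rho0] at k0
    rw [rho1] at k1
    simp only [map_mul, rho0, rho1] at k2
    have hb := basis_par α⁻¹ (par ![1, 0])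
    have hne : par ![1, 0] ≠ 1 := by
      intro h
      have := DFunLike.congr_fun h (FreeGroup.of 0)
      simp [par] at this
    rcases zm (par ![1, 0] (α⁻¹ (FreeGroup.of 0))) with e0 | e0 <;>
    rcases zm (par ![1, 0] (α⁻¹ (FreeGroup.of 1))) with e1 | e1
    · exact hne (hb e0 e1)
    · rw [e1] at k1
      rw [e0, e1] at k2
      exact haxis (Or.inr (Or.inr ⟨k1 (by decide), k2 (by decide)⟩))
    · rw [e0] at k0
      rw [e0, e1] at k2
      exact haxis (Or.inr (Or.inl ⟨k0 (by decide), k2 (by decide)⟩))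
    · rw [e0] at k0
      rw [e1] at k1
      exact haxis (Or.inl ⟨k0 (by decide), k1 (by decide)⟩)
  · intro hd
    have := det_words _ _ hd (α⁻¹ (FreeGroup.of 0)) (α⁻¹ (FreeGroup.of 1))
    rw [hA, hA, rho0, rho1, det_comm] at this
    apply hE
    simp only [Matrix.SpecialLinearGroup.det_coe] at this
    simp only [E, Matrix.SpecialLinearGroup.coe_mul]
    linear_combination (-1 / 4) * this

end Aux

theorem stmt4 (A₁ A₂ : SL2C)
    (htr1 : (Matrix.trace ((A₁ : Matrix (Fin 2) (Fin 2) ℂ))).im = 0)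
    (htr2 : (Matrix.trace ((A₂ : Matrix (Fin 2) (Fin 2) ℂ))).im = 0)
    (htr12 : (Matrix.trace (((A₁ * A₂ : SL2C) : Matrix (Fin 2) (Fin 2) ℂ))).im = 0)
    (hper : ElemPeriodic A₁ A₂)
    (hE : E (chi A₁ A₂ 1).1 (chi A₁ A₂ 1).2.1 (chi A₁ A₂ 1).2.2 ≠ 1)
    (haxis : ¬ (((chi A₁ A₂ 1).1 = 0 ∧ (chi A₁ A₂ 1).2.1 = 0) ∨
                ((chi A₁ A₂ 1).1 = 0 ∧ (chi A₁ A₂ 1).2.2 = 0) ∨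
                ((chi A₁ A₂ 1).2.1 = 0 ∧ (chi A₁ A₂ 1).2.2 = 0))) :
    IsOfFinOrder A₂ ∧
    ∀ α : MulAut (FreeGroup (Fin 2)), IsOfFinOrder (rho A₁ A₂ (α (FreeGroup.of 1))) := by
  refine ⟨?_, Aux.main A₁ A₂ hper hE haxis⟩
  have := Aux.main A₁ A₂ hper hE haxis 1
  rwa [MulAut.one_apply, Aux.rho1] at this

end
end

section
/- Let A₁, A₂ ∈ SL(2,ℂ) with tr A₁, tr A₂ and tr(A₁A₂) all real, let (A₁,A₂) be elementwise-periodic, and suppose E(χ(id)) ≠ 1 and χ(id) does not lie on a coordinate axis of ℝ³ (i.e. no two of its three coordinates are both zero). Then for every integer h, each of the matrices A₁A₂ʰ, A₂A₁ʰ, A₁(A₁A₂)ʰ and A₂(A₁A₂)ʰ has finite order in SL(2,ℂ). -/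
open Matrix

noncomputable section

/-- Trace on `SL(2,ℂ)`. -/
def tt (X : SL2C) : ℂ := Matrix.trace (X : Matrix (Fin 2) (Fin 2) ℂ)

lemma tt_det (X : SL2C) : X.1 0 0 * X.1 1 1 - X.1 0 1 * X.1 1 0 = 1 := by
  have h := X.2
  rwa [Matrix.det_fin_two] at h

lemma tt_eq (X : SL2C) : tt X = X.1 0 0 + X.1 1 1 := by
  simp [tt, Matrix.trace_fin_two]

lemma tt_comm (X Y : SL2C) : tt (X * Y) = tt (Y * X) := by
  simp only [tt, Matrix.SpecialLinearGroup.coe_mul]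
  exact Matrix.trace_mul_comm _ _

lemma tt_inv (X : SL2C) : tt X⁻¹ = tt X := by
  simp [tt, Matrix.trace_fin_two, Matrix.SpecialLinearGroup.coe_inv, Matrix.adjugate_fin_two, add_comm]

lemma tt_rec (X B : SL2C) : tt (X * B * B) = tt B * tt (X * B) - tt X := by
  have hB := tt_det B
  simp only [tt, Matrix.trace_fin_two, Matrix.SpecialLinearGroup.coe_mul, Matrix.mul_apply,
    Fin.sum_univ_two]
  linear_combination (-(X.1 0 0 + X.1 1 1)) * hB

lemma tt_comut (C W : SL2C) : tt (C * W * C⁻¹ * W⁻¹) =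
    tt C ^ 2 + tt W ^ 2 + tt (C * W) ^ 2 - tt C * tt W * tt (C * W) - 2 := by
  have hC := tt_det C
  have hW := tt_det W
  have key : ∀ X Y : SL2C, tt (X * Y⁻¹) = tt X * tt Y - tt (X * Y) := by
    intro X Y
    have h := tt_rec (X * Y⁻¹) Y
    simp only [inv_mul_cancel_right] at h
    linear_combination h
  have h1 : tt (C * W * C⁻¹ * W) = tt (C * W) * tt (C⁻¹ * W) - tt (C * C) := by
    have h := key (C * W) (W⁻¹ * C)
    simp only [_root_.mul_inv_rev, inv_inv] at h
    have e1 : C * W * (C⁻¹ * W) = C * W * C⁻¹ * W := by group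
    have e2 : C * W * (W⁻¹ * C) = C * C := by group
    have e3 : tt (W⁻¹ * C) = tt (C⁻¹ * W) := by
      rw [← tt_inv (W⁻¹ * C)]; simp
    rw [e1, e2, e3] at h
    exact h
  have h2 : tt (C⁻¹ * W) = tt C * tt W - tt (C * W) := by
    rw [tt_comm, key, tt_comm C W]; ring
  have h3 : tt (C * C) = tt C ^ 2 - 2 := by
    have h := tt_rec 1 C
    have : tt (1 : SL2C) = 2 := by simp [tt]
    simp only [one_mul, this] at h
    linear_combination h
  have h4 : tt (C * W * C⁻¹) = tt W := by
    rw [tt_comm]; congr 1; group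
  rw [key, h1, h2, h3, h4]; ring

lemma ch_sl (C : SL2C) : (C.1) * C.1 = tt C • C.1 - 1 := by
  have hC := tt_det C
  rw [tt_eq]
  ext i j
  fin_cases i <;> fin_cases j <;>
    simp [Matrix.mul_apply, Fin.sum_univ_two] <;>
    first | ring1 | linear_combination hC | linear_combination (-1) * hC

lemma pow_lin (C : SL2C) (n : ℕ) : ∃ p q : ℂ, (C.1) ^ n = p • C.1 + q • 1 := by
  induction n with
  | zero => exact ⟨0, 1, by simp⟩
  | succ n ih =>
    obtain ⟨p, q, h⟩ := ih
    refine ⟨p * tt C + q, -p, ?_⟩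
    rw [pow_succ, h, add_mul, smul_mul_assoc, ch_sl]
    simp only [smul_sub, smul_mul_assoc, one_mul, add_smul, neg_smul, mul_smul]
    abel

lemma fin_order_core (C W : SL2C) (hfin : (Set.range fun k : ℕ => tt (W * C ^ k)).Finite)
    (h0 : ¬ (tt W = 0 ∧ tt (W * C) = 0))
    (hE : tt C ^ 2 + tt W ^ 2 + tt (W * C) ^ 2 - tt C * tt W * tt (W * C) ≠ 4) :
    IsOfFinOrder C := by
  set s : ℕ → ℂ := fun k => tt (W * C ^ k) with hs
  have hrec : ∀ k, s (k + 2) = tt C * s (k + 1) - s k := by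
    intro k
    have h := tt_rec (W * C ^ k) C
    simp only [hs, pow_succ, ← mul_assoc] at h ⊢
    exact h
  have s0 : s 0 = tt W := by simp [hs]
  have s1 : s 1 = tt (W * C) := by simp [hs]
  -- periodicity
  obtain ⟨n, hn, hn0, hn1⟩ : ∃ n : ℕ, 0 < n ∧ s n = s 0 ∧ s (n + 1) = s 1 := by
    have hinj : ¬ Function.Injective (fun k : ℕ => (s k, s (k + 1))) := by
      intro hi
      have : (Set.range (fun k : ℕ => (s k, s (k + 1)))).Finite := by
        refine (hfin.prod hfin).subset ?_
        rintro _ ⟨k, rfl⟩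
        exact ⟨⟨k, rfl⟩, ⟨k + 1, rfl⟩⟩
      exact Set.infinite_range_of_injective hi this
    have hdown : ∀ i n, s (i + n) = s i → s (i + n + 1) = s (i + 1) →
        s n = s 0 ∧ s (n + 1) = s 1 := by
      intro i
      induction i with
      | zero => intro n h1 h2; simpa using And.intro h1 h2
      | succ i ih =>
        intro n h1 h2
        have e : i + 1 + n = i + n + 1 := by ring
        rw [e] at h1 h2
        refine ih n ?_ h1
        have r1 := hrec (i + n)
        have r2 := hrec i
        have h2' : s (i + n + 2) = s (i + 2) := h2
        linear_combination r1 - r2 - h2' + tt C * h1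
    simp only [Function.Injective, not_forall] at hinj
    obtain ⟨i, j, hij, hne⟩ := hinj
    simp only [Prod.mk.injEq] at hij
    rcases lt_or_gt_of_ne hne with h | h
    · obtain ⟨d, rfl⟩ := Nat.exists_eq_add_of_lt h
      have := hdown i (d + 1) hij.1.symm hij.2.symm
      exact ⟨d + 1, by omega, this⟩
    · obtain ⟨d, rfl⟩ := Nat.exists_eq_add_of_lt h
      have := hdown j (d + 1) hij.1 hij.2
      exact ⟨d + 1, by omega, this⟩
  rw [isOfFinOrder_iff_pow_eq_one]
  refine ⟨n, hn, ?_⟩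
  apply Subtype.ext
  change ((C ^ n : SL2C) : Matrix (Fin 2) (Fin 2) ℂ) = ((1 : SL2C) : Matrix (Fin 2) (Fin 2) ℂ)
  rw [Matrix.SpecialLinearGroup.coe_pow, Matrix.SpecialLinearGroup.coe_one]
  obtain ⟨p, q, hpq⟩ := pow_lin C n
  have f0 : s n = p * s 1 + q * s 0 := by
    rw [s0, s1]
    simp only [hs, tt, Matrix.SpecialLinearGroup.coe_mul, Matrix.SpecialLinearGroup.coe_pow]
    rw [show (C : Matrix (Fin 2) (Fin 2) ℂ) ^ n = _ from hpq]
    simp [mul_add]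
  have f1 : s (n + 1) = p * s 2 + q * s 1 := by
    rw [s1]
    simp only [hs, tt, Matrix.SpecialLinearGroup.coe_mul, Matrix.SpecialLinearGroup.coe_pow]
    rw [pow_succ, show (C : Matrix (Fin 2) (Fin 2) ℂ) ^ n = _ from hpq]
    simp [mul_add, add_mul, pow_two]
  have r0 : s 2 = tt C * s 1 - s 0 := hrec 0
  rw [← s0, ← s1] at h0 hE
  by_cases hdet : s 1 ^ 2 - s 0 * s 2 = 0
  · -- eigenvalue case
    have q0 : s 1 ^ 2 - tt C * s 0 * s 1 + s 0 ^ 2 = 0 := by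
      rw [r0] at hdet; linear_combination hdet
    have hs0 : s 0 ≠ 0 := by
      intro h
      apply h0
      refine ⟨h, ?_⟩
      rw [h] at q0
      simpa using q0
    have htau : tt C ^ 2 ≠ 4 := by
      intro h
      apply hE
      linear_combination h + q0
    obtain ⟨l, hl⟩ : ∃ l, s 1 = l * s 0 := ⟨s 1 / s 0, by field_simp⟩
    have hlq : l ^ 2 - tt C * l + 1 = 0 := by
      have : s 0 ^ 2 * (l ^ 2 - tt C * l + 1) = 0 := by
        rw [hl] at q0; linear_combination q0
      simpa [hs0] using this
    have hpw : ∀ k, s k = l ^ k * s 0 ∧ s (k + 1) = l ^ (k + 1) * s 0 := by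
      intro k
      induction k with
      | zero => simp [hl]
      | succ k ih =>
        refine ⟨ih.2, ?_⟩
        rw [hrec k, ih.1, ih.2]
        linear_combination (-(l ^ k * s 0)) * hlq
    have hln : l ^ n = 1 := by
      have := (hpw n).1
      rw [hn0] at this
      have h2 : (l ^ n - 1) * s 0 = 0 := by linear_combination -this
      rcases mul_eq_zero.1 h2 with h | h
      · linear_combination h
      · exact absurd h hs0
    set m := tt C - l with hm
    have hlm : l * m = 1 := by rw [hm]; linear_combination -hlq
    have hmn : m ^ n = 1 := by
      have : (l * m) ^ n = 1 := by rw [hlm, one_pow]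
      rwa [mul_pow, hln, one_mul] at this
    have hne : l - m ≠ 0 := by
      intro h
      apply htau
      have : tt C = l + m := by rw [hm]; ring
      rw [this]
      linear_combination (l - m) * h + 4 * hlm
    -- now p l + q = 1 = p m + q
    have hcop : ∀ k : ℕ, ∃ p q : ℂ,
        (C.1) ^ k = p • C.1 + q • 1 ∧ l ^ k = p * l + q ∧ m ^ k = p * m + q := by
      intro k
      induction k with
      | zero => exact ⟨0, 1, by simp⟩
      | succ k ih =>
        obtain ⟨p, q, h, h1, h2⟩ := ih
        refine ⟨p * tt C + q, -p, ?_, ?_, ?_⟩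
        · rw [pow_succ, h, add_mul, smul_mul_assoc, ch_sl]
          simp only [smul_sub, smul_mul_assoc, one_mul, add_smul, neg_smul, mul_smul]
          abel
        · rw [pow_succ, h1]; linear_combination p * hlq
        · rw [pow_succ, h2, hm]; linear_combination p * hlq
    obtain ⟨p', q', h, h1, h2⟩ := hcop n
    rw [hln] at h1
    rw [hmn] at h2
    have hp : p' = 0 := by
      have : p' * (l - m) = 0 := by linear_combination h2 - h1
      exact (mul_eq_zero.1 this).resolve_right hne
    have hq : q' = 1 := by rw [hp] at h1; linear_combination -h1
    rw [hp, hq] at h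
    simpa using h
  · have e0 : p * s 1 + (q - 1) * s 0 = 0 := by linear_combination hn0 - f0
    have e1 : p * s 2 + (q - 1) * s 1 = 0 := by linear_combination hn1 - f1
    have hp : p = 0 := by
      have : p * (s 1 ^ 2 - s 0 * s 2) = 0 := by linear_combination s 1 * e0 - s 0 * e1
      exact (mul_eq_zero.1 this).resolve_right hdet
    have hq : q - 1 = 0 := by
      have : (q - 1) * (s 1 ^ 2 - s 0 * s 2) = 0 := by linear_combination s 1 * e1 - s 2 * e0
      exact (mul_eq_zero.1 this).resolve_right hdet
    have hq' : q = 1 := by linear_combination hq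
    rw [hp, hq'] at hpq
    simpa using hpq

lemma fin_order_twist (A B : SL2C) (h : ℤ)
    (hfin : (Set.range fun k : ℕ => tt (B * (A * B ^ h) ^ k)).Finite)
    (h0 : tt B = 0 → tt A ≠ 0 ∧ tt (A * B) ≠ 0)
    (hE : tt (A * B * A⁻¹ * B⁻¹) ≠ 2) :
    IsOfFinOrder (A * B ^ h) := by
  apply fin_order_core _ B hfin
  · rintro ⟨hB, hC⟩
    obtain ⟨ha, hb⟩ := h0 hB
    have hr : ∀ i : ℤ, tt (A * B ^ (i + 2)) = - tt (A * B ^ i) := by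
      intro i
      have := tt_rec (A * B ^ i) B
      rw [hB, zero_mul, zero_sub] at this
      rw [← this]; congr 1; group
    have hall : ∀ i : ℤ, tt (A * B ^ i) ≠ 0 ∧ tt (A * B ^ (i + 1)) ≠ 0 := by
      intro i
      induction i using Int.induction_on with
      | zero => simpa using And.intro ha hb
      | succ i ih =>
        refine ⟨ih.2, ?_⟩
        have := hr i
        rw [show (i : ℤ) + 1 + 1 = i + 2 by ring, this]
        simpa using ih.1
      | pred i ih =>
        have e := hr (-(i : ℤ) - 1)
        rw [show -(i : ℤ) - 1 + 2 = -i + 1 by ring] at e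
        refine ⟨?_, ?_⟩
        · intro hz
          apply ih.2
          rw [e, hz, neg_zero]
        · rw [show -(i : ℤ) - 1 + 1 = -i by ring]; exact ih.1
    apply (hall h).2
    rw [← hC, tt_comm B]
    congr 1; group
  · intro hc
    apply hE
    have := tt_comut (A * B ^ h) B
    rw [tt_comm (A * B ^ h) B] at this
    have e : A * B ^ h * B * (A * B ^ h)⁻¹ * B⁻¹ = A * B * A⁻¹ * B⁻¹ := by group
    rw [e] at this
    rw [this]
    linear_combination hc

/-- Automorphisms of the free group from images of generators with explicit inverse. -/
lemma exists_aut (c w : FreeGroup (Fin 2)) (u v : FreeGroup (Fin 2))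
    (h1 : FreeGroup.lift ![c, w] u = FreeGroup.of 0) (h2 : FreeGroup.lift ![c, w] v = FreeGroup.of 1)
    (h3 : FreeGroup.lift ![u, v] c = FreeGroup.of 0) (h4 : FreeGroup.lift ![u, v] w = FreeGroup.of 1) :
    ∃ φ : MulAut (FreeGroup (Fin 2)), φ (FreeGroup.of 0) = c ∧ φ (FreeGroup.of 1) = w := by
  refine ⟨MonoidHom.toMulEquiv (FreeGroup.lift ![c, w]) (FreeGroup.lift ![u, v]) ?_ ?_, ?_, ?_⟩
  · ext i; fin_cases i <;> simp [h3, h4]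
  · ext i; fin_cases i <;> simp [h1, h2]
  · simp
  · simp

lemma exists_twist (φ : MulAut (FreeGroup (Fin 2))) :
    ∃ α : MulAut (FreeGroup (Fin 2)), ∀ k : ℕ, (α ^ k) (φ (FreeGroup.of 1)) =
      φ (FreeGroup.of 1) * φ (FreeGroup.of 0) ^ k := by
  obtain ⟨T, h0, h1⟩ := exists_aut (FreeGroup.of 0) (FreeGroup.of 1 * FreeGroup.of 0)
    (FreeGroup.of 0) (FreeGroup.of 1 * (FreeGroup.of 0)⁻¹) (by simp) (by simp) (by simp) (by simp)
  refine ⟨φ * T * φ⁻¹, fun k => ?_⟩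
  have hc : (φ * T * φ⁻¹) (φ (FreeGroup.of 0)) = φ (FreeGroup.of 0) := by
    simp [MulAut.mul_apply, h0]
  have hw : (φ * T * φ⁻¹) (φ (FreeGroup.of 1)) = φ (FreeGroup.of 1) * φ (FreeGroup.of 0) := by
    simp [MulAut.mul_apply, h1]
  induction k with
  | zero => simp
  | succ k ih =>
    rw [pow_succ', MulAut.mul_apply, ih, map_mul, map_pow, hc, hw, pow_succ', mul_assoc]

lemma fin_seq (A₁ A₂ : SL2C) (hper : ElemPeriodic A₁ A₂) (c w : FreeGroup (Fin 2))
    (hφ : ∃ φ : MulAut (FreeGroup (Fin 2)), φ (FreeGroup.of 0) = c ∧ φ (FreeGroup.of 1) = w)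
    (hw : w = FreeGroup.of 0 ∨ w = FreeGroup.of 1 ∨ w = FreeGroup.of 0 * FreeGroup.of 1) :
    (Set.range fun k : ℕ => tt (rho A₁ A₂ w * rho A₁ A₂ c ^ k)).Finite := by
  obtain ⟨φ, rfl, rfl⟩ := hφ
  obtain ⟨α, hα⟩ := exists_twist φ
  have hk : ∀ k, tt (rho A₁ A₂ (φ (FreeGroup.of 1)) * rho A₁ A₂ (φ (FreeGroup.of 0)) ^ k) =
      tt (rho A₁ A₂ ((α ^ k) (φ (FreeGroup.of 1)))) := by
    intro k; rw [hα, map_mul, map_pow]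
  simp only [hk]
  have hf := hper α
  rcases hw with h | h | h <;> rw [h]
  · refine (hf.image (fun p => 2 * p.1)).subset ?_
    rintro _ ⟨k, rfl⟩
    exact ⟨_, ⟨k, rfl⟩, by simp [chi, tt]; ring⟩
  · refine (hf.image (fun p => 2 * p.2.1)).subset ?_
    rintro _ ⟨k, rfl⟩
    exact ⟨_, ⟨k, rfl⟩, by simp [chi, tt]; ring⟩
  · refine (hf.image (fun p => 2 * p.2.2)).subset ?_
    rintro _ ⟨k, rfl⟩
    exact ⟨_, ⟨k, rfl⟩, by simp only [chi, tt]; ring⟩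

theorem stmt5 (A₁ A₂ : SL2C)
    (htr1 : (Matrix.trace ((A₁ : Matrix (Fin 2) (Fin 2) ℂ))).im = 0)
    (htr2 : (Matrix.trace ((A₂ : Matrix (Fin 2) (Fin 2) ℂ))).im = 0)
    (htr12 : (Matrix.trace (((A₁ * A₂ : SL2C) : Matrix (Fin 2) (Fin 2) ℂ))).im = 0)
    (hper : ElemPeriodic A₁ A₂)
    (hE : E (chi A₁ A₂ 1).1 (chi A₁ A₂ 1).2.1 (chi A₁ A₂ 1).2.2 ≠ 1)
    (haxis : ¬ (((chi A₁ A₂ 1).1 = 0 ∧ (chi A₁ A₂ 1).2.1 = 0) ∨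
                ((chi A₁ A₂ 1).1 = 0 ∧ (chi A₁ A₂ 1).2.2 = 0) ∨
                ((chi A₁ A₂ 1).2.1 = 0 ∧ (chi A₁ A₂ 1).2.2 = 0))) :
    ∀ h : ℤ,
      IsOfFinOrder (A₁ * A₂ ^ h) ∧ IsOfFinOrder (A₂ * A₁ ^ h) ∧
      IsOfFinOrder (A₁ * (A₁ * A₂) ^ h) ∧ IsOfFinOrder (A₂ * (A₁ * A₂) ^ h) := by
  intro h
  have r0 : rho A₁ A₂ (FreeGroup.of 0) = A₁ := by simp [rho]
  have r1 : rho A₁ A₂ (FreeGroup.of 1) = A₂ := by simp [rho]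
  have c1 : (chi A₁ A₂ 1).1 = tt A₁ / 2 := by simp [chi, tt, r0]
  have c2 : (chi A₁ A₂ 1).2.1 = tt A₂ / 2 := by simp [chi, tt, r1]
  have c3 : (chi A₁ A₂ 1).2.2 = tt (A₁ * A₂) / 2 := by simp [chi, tt, r0, r1]
  rw [c1, c2, c3] at hE haxis
  have hz : ∀ u : ℂ, u / 2 = 0 ↔ u = 0 := by intro u; simp
  simp only [hz] at haxis
  push Not at haxis
  obtain ⟨x12, x13, x23⟩ := haxis
  have hcomm : tt (A₁ * A₂ * A₁⁻¹ * A₂⁻¹) ≠ 2 := by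
    intro hc
    rw [tt_comut] at hc
    apply hE
    simp only [E]
    linear_combination hc / 4
  have hcomm2 : tt (A₂ * A₁ * A₂⁻¹ * A₁⁻¹) ≠ 2 := by
    rw [← tt_inv]
    convert hcomm using 2
    group
  have f1 := fin_seq A₁ A₂ hper (FreeGroup.of 0 * FreeGroup.of 1 ^ h) (FreeGroup.of 1)
    (exists_aut _ _ (FreeGroup.of 0 * FreeGroup.of 1 ^ (-h)) (FreeGroup.of 1)
      (by simp) (by simp) (by simp) (by simp)) (by simp)
  have f2 := fin_seq A₁ A₂ hper (FreeGroup.of 1 * FreeGroup.of 0 ^ h) (FreeGroup.of 0)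
    (exists_aut _ _ (FreeGroup.of 1) (FreeGroup.of 0 * FreeGroup.of 1 ^ (-h))
      (by simp) (by simp) (by simp) (by simp)) (by simp)
  have f3 := fin_seq A₁ A₂ hper (FreeGroup.of 0 * (FreeGroup.of 0 * FreeGroup.of 1) ^ h)
    (FreeGroup.of 0 * FreeGroup.of 1)
    (exists_aut _ _ (FreeGroup.of 0 * FreeGroup.of 1 ^ (-h))
      (FreeGroup.of 1 ^ h * (FreeGroup.of 0)⁻¹ * FreeGroup.of 1)
      (by simp) (by simp) (by simp [mul_assoc]) (by simp [mul_assoc])) (by simp)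
  have f4 := fin_seq A₁ A₂ hper (FreeGroup.of 1 * (FreeGroup.of 0 * FreeGroup.of 1) ^ h)
    (FreeGroup.of 0 * FreeGroup.of 1)
    (exists_aut _ _ (FreeGroup.of 1 * FreeGroup.of 1 ^ h * (FreeGroup.of 0)⁻¹)
      (FreeGroup.of 0 * FreeGroup.of 1 ^ (-h))
      (by simp [mul_assoc]) (by simp) (by simp [mul_assoc]) (by simp [mul_assoc])) (by simp)
  simp only [map_mul, map_zpow, r0, r1] at f1 f2 f3 f4
  refine ⟨fin_order_twist _ _ h f1 ?_ hcomm, fin_order_twist _ _ h f2 ?_ hcomm2,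
    fin_order_twist _ _ h f3 ?_ ?_, fin_order_twist _ _ h f4 ?_ ?_⟩
  · intro hy
    exact ⟨fun hx => x12 hx hy, x23 hy⟩
  · intro hx
    exact ⟨x12 hx, by rw [tt_comm]; exact x13 hx⟩
  · intro hz
    refine ⟨fun hx => x13 hx hz, ?_⟩
    have e := tt_rec A₂ A₁
    rw [tt_comm A₂ A₁, hz, mul_zero, zero_sub] at e
    rw [← mul_assoc, tt_comm, ← mul_assoc, e, neg_ne_zero]
    exact fun hy => x23 hy hz
  · have e : A₁ * (A₁ * A₂) * A₁⁻¹ * (A₁ * A₂)⁻¹ = A₁ * (A₁ * A₂ * A₁⁻¹ * A₂⁻¹ * A₁⁻¹) := by group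
    rw [e, tt_comm, inv_mul_cancel_right]
    exact hcomm
  · intro hz
    refine ⟨fun hy => x23 hy hz, ?_⟩
    have e := tt_rec A₁ A₂
    rw [hz, mul_zero, zero_sub] at e
    rw [tt_comm, e, neg_ne_zero]
    exact fun hx => x13 hx hz
  · have e : A₂ * (A₁ * A₂) * A₂⁻¹ * (A₁ * A₂)⁻¹ = A₂ * A₁ * A₂⁻¹ * A₁⁻¹ := by group
    rw [e]
    exact hcomm2


end
end

section
/- Let A₁, A₂ ∈ SL(2,ℂ) with tr A₁, tr A₂ and tr(A₁A₂) all real, let (A₁,A₂) be elementwise-periodic, and suppose E(χ(id)) = 1 and χ(id) ∉ V, where V = {(1,1,1), (−1,−1,1), (−1,1,−1), (1,−1,−1)}. Then: (i) there exists P ∈ GL(2,ℂ) such that P A₁ P⁻¹ and P A₂ P⁻¹ are both lower triangular; and (ii) there exists an automorphism α of F₂ such that some coordinate of χ(α) equals 1. -/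
open Matrix

noncomputable section

lemma quad_root (b e c : ℂ) : ∃ x y : ℂ, (x ≠ 0 ∨ y ≠ 0) ∧ b * x ^ 2 + e * x * y - c * y ^ 2 = 0 := by
  by_cases hb : b = 0
  · exact ⟨1, 0, Or.inl one_ne_zero, by simp [hb]⟩
  · obtain ⟨s, hs⟩ := IsAlgClosed.exists_pow_nat_eq (e ^ 2 + 4 * b * c) (n := 2) (by norm_num)
    refine ⟨(s - e) / (2 * b), 1, Or.inr one_ne_zero, ?_⟩
    field_simp
    linear_combination hs

lemma common_root (b e c b' e' c' : ℂ)
    (h : (b * c' - b' * c) ^ 2 + (b * e' - b' * e) * (e * c' - e' * c) = 0) :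
    ∃ x y : ℂ, (x ≠ 0 ∨ y ≠ 0) ∧ b * x ^ 2 + e * x * y - c * y ^ 2 = 0 ∧
      b' * x ^ 2 + e' * x * y - c' * y ^ 2 = 0 := by
  by_cases hq : b * e' - b' * e = 0
  · have hp : b * c' - b' * c = 0 := by
      rw [hq] at h; simpa using h
    by_cases hr : e * c' - e' * c = 0
    · by_cases hb : b = 0
      · by_cases he : e = 0
        · by_cases hc : c = 0
          · obtain ⟨x, y, h0, h1⟩ := quad_root b' e' c'
            exact ⟨x, y, h0, by simp [hb, he, hc], h1⟩
          · obtain ⟨x, y, h0, h1⟩ := quad_root b e c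
            refine ⟨x, y, h0, h1, mul_left_cancel₀ hc ?_⟩
            linear_combination c' * h1 - x ^ 2 * hp - x * y * hr
        · obtain ⟨x, y, h0, h1⟩ := quad_root b e c
          refine ⟨x, y, h0, h1, mul_left_cancel₀ he ?_⟩
          linear_combination e' * h1 - x ^ 2 * hq - y ^ 2 * hr
      · obtain ⟨x, y, h0, h1⟩ := quad_root b e c
        refine ⟨x, y, h0, h1, mul_left_cancel₀ hb ?_⟩
        linear_combination b' * h1 + x * y * hq - y ^ 2 * hp
    · have hb : b = 0 := by
        apply (mul_eq_zero.1 (?_ : b * (e * c' - e' * c) = 0)).resolve_right hr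
        linear_combination e * hp - c * hq
      have hb' : b' = 0 := by
        apply (mul_eq_zero.1 (?_ : b' * (e * c' - e' * c) = 0)).resolve_right hr
        linear_combination e' * hp - c' * hq
      exact ⟨1, 0, Or.inl one_ne_zero, by simp [hb], by simp [hb']⟩
  · refine ⟨b * c' - b' * c, b * e' - b' * e, Or.inr hq, ?_, ?_⟩
    · linear_combination b * h
    · linear_combination b' * h

lemma par {x y u w : ℂ} (h0 : x ≠ 0 ∨ y ≠ 0) (h : x * w = y * u) :
    ∃ c : ℂ, u = c * x ∧ w = c * y := by
  rcases h0 with h0 | h0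
  · refine ⟨u / x, by field_simp, ?_⟩
    field_simp; linear_combination h
  · refine ⟨w / y, ?_, by field_simp⟩
    field_simp; linear_combination -h

lemma trace_eig {x y c : ℂ} (M : SL2C) (h0 : x ≠ 0 ∨ y ≠ 0)
    (h1 : x * M.1 0 0 + y * M.1 1 0 = c * x) (h2 : x * M.1 0 1 + y * M.1 1 1 = c * y) :
    c ^ 2 - M.1.trace * c + 1 = 0 := by
  have hd := M.2
  rw [Matrix.det_fin_two] at hd
  rw [Matrix.trace_fin_two]
  generalize M.1 0 0 = a at *
  generalize M.1 0 1 = b at *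
  generalize M.1 1 0 = e at *
  generalize M.1 1 1 = d at *
  rcases h0 with h0 | h0
  · apply mul_left_cancel₀ h0
    linear_combination (d - c) * h1 - e * h2 - x * hd
  · apply mul_left_cancel₀ h0
    linear_combination (a - c) * h2 - b * h1 - y * hd

lemma eig_ne {x y c : ℂ} (M : SL2C) (h0 : x ≠ 0 ∨ y ≠ 0)
    (h1 : x * M.1 0 0 + y * M.1 1 0 = c * x) (h2 : x * M.1 0 1 + y * M.1 1 1 = c * y) :
    c ≠ 0 := by
  rintro rfl
  simpa using trace_eig M h0 h1 h2

lemma low {x y : ℂ} (P : GL (Fin 2) ℂ) (A : SL2C) (l : ℂ) (hx : P.1 0 0 = x) (hy : P.1 0 1 = y)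
    (h1 : x * A.1 0 0 + y * A.1 1 0 = l * x) (h2 : x * A.1 0 1 + y * A.1 1 1 = l * y) :
    ((P : Matrix (Fin 2) (Fin 2) ℂ) * (A : Matrix (Fin 2) (Fin 2) ℂ) *
        ((P⁻¹ : GL (Fin 2) ℂ) : Matrix (Fin 2) (Fin 2) ℂ)) 0 1 = 0 := by
  have hP : ((P : Matrix (Fin 2) (Fin 2) ℂ) *
      ((P⁻¹ : GL (Fin 2) ℂ) : Matrix (Fin 2) (Fin 2) ℂ)) 0 1 = 0 := by
    rw [Units.mul_inv]; simp
  subst hx hy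
  rw [Matrix.mul_apply, Fin.sum_univ_two] at hP ⊢
  rw [Matrix.mul_apply, Matrix.mul_apply, Fin.sum_univ_two, Fin.sum_univ_two, h1, h2]
  linear_combination l * hP

abbrev F2 := FreeGroup (Fin 2)

/-- swap -/
def autS : MulAut F2 := FreeGroup.freeGroupCongr (Equiv.swap 0 1)

@[simp] lemma autS0 : autS (FreeGroup.of 0) = FreeGroup.of 1 := by simp [autS]
@[simp] lemma autS1 : autS (FreeGroup.of 1) = FreeGroup.of 0 := by simp [autS]

/-- transvection -/
def autU : MulAut F2 := MonoidHom.toMulEquiv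
  (FreeGroup.lift ![FreeGroup.of 0, FreeGroup.of 1 * FreeGroup.of 0])
  (FreeGroup.lift ![FreeGroup.of 0, FreeGroup.of 1 * (FreeGroup.of 0)⁻¹])
  (by ext i; fin_cases i <;> simp)
  (by ext i; fin_cases i <;> simp)

@[simp] lemma autU0 : autU (FreeGroup.of 0) = FreeGroup.of 0 := by simp [autU]
@[simp] lemma autU1 : autU (FreeGroup.of 1) = FreeGroup.of 1 * FreeGroup.of 0 := by simp [autU]
@[simp] lemma autUi0 : autU⁻¹ (FreeGroup.of 0) = FreeGroup.of 0 := by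
  rw [MulAut.inv_apply, MulEquiv.symm_apply_eq]; simp
@[simp] lemma autUi1 : autU⁻¹ (FreeGroup.of 1) = FreeGroup.of 1 * (FreeGroup.of 0)⁻¹ := by
  rw [MulAut.inv_apply, MulEquiv.symm_apply_eq]; simp

lemma autU_pow (k : ℕ) : (autU ^ k) (FreeGroup.of 0) = FreeGroup.of 0 ∧
    (autU ^ k) (FreeGroup.of 1) = FreeGroup.of 1 * FreeGroup.of 0 ^ k := by
  induction k with
  | zero => simp
  | succ k ih =>
    rw [pow_succ]
    simp [MulAut.mul_apply, ih.1, ih.2, pow_succ, mul_assoc]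

lemma euclid (ζ : ℂˣ) : ∀ n a b : ℕ, a + b ≤ n → ∀ φ : F2 →* ℂˣ, φ (FreeGroup.of 0) = ζ ^ a →
    φ (FreeGroup.of 1) = ζ ^ b → ∃ α : MulAut F2, φ (α (FreeGroup.of 0)) = 1 := by
  intro n
  induction n with
  | zero =>
    intro a b hab φ h0 h1
    obtain rfl : a = 0 := by omega
    exact ⟨1, by simpa using h0⟩
  | succ n ih =>
    intro a b hab φ h0 h1
    rcases Nat.eq_zero_or_pos a with rfl | ha
    · exact ⟨1, by simpa using h0⟩
    rcases Nat.eq_zero_or_pos b with rfl | hb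
    · exact ⟨autS, by simpa using h1⟩
    rcases le_total a b with h | h
    · obtain ⟨α, hα⟩ := ih a (b - a) (by omega) (φ.comp (autU⁻¹ : MulAut F2).toMonoidHom)
        (by
          show φ (autU⁻¹ (FreeGroup.of 0)) = _
          rw [autUi0, h0]) (by
          show φ (autU⁻¹ (FreeGroup.of 1)) = _
          rw [autUi1, map_mul, map_inv, h0, h1, pow_sub _ h])
      exact ⟨autU⁻¹ * α, hα⟩
    · obtain ⟨α, hα⟩ := ih b (a - b) (by omega) (φ.comp (autS * autU⁻¹ : MulAut F2).toMonoidHom)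
        (by
          show φ (autS (autU⁻¹ (FreeGroup.of 0))) = _
          rw [autUi0, autS0, h1]) (by
          show φ (autS (autU⁻¹ (FreeGroup.of 1))) = _
          rw [autUi1, map_mul, map_inv, autS0, autS1, map_mul, map_inv, h0, h1, pow_sub _ h])
      exact ⟨autS * autU⁻¹ * α, hα⟩

lemma finite_order (l m : ℂˣ) (f : ℕ → ℂ) (hf : (Set.range f).Finite)
    (h : ∀ k, ((m * l ^ k : ℂˣ) : ℂ) ^ 2 - f k * ((m * l ^ k : ℂˣ) : ℂ) + 1 = 0) :
    ∃ n : ℕ, 0 < n ∧ l ^ n = 1 := by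
  have hfin : (Set.range fun k : ℕ => ((m * l ^ k : ℂˣ) : ℂ)).Finite := by
    refine Set.Finite.subset (hf.biUnion (t := fun t => {z : ℂ | z ^ 2 - t * z + 1 = 0}) ?_) ?_
    · intro t _
      have hp : (Polynomial.X ^ 2 - Polynomial.C t * Polynomial.X + 1 : Polynomial ℂ) ≠ 0 := by
        intro h0
        have := congrArg (Polynomial.eval 0) h0
        simp at this
      refine (Polynomial.finite_setOfPred_isRoot hp).subset ?_
      intro z hz
      simpa [Polynomial.IsRoot] using hz
    · rintro _ ⟨k, rfl⟩
      simp only [Set.mem_iUnion]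
      exact ⟨f k, ⟨k, rfl⟩, h k⟩
  have hni : ¬ Function.Injective (fun k : ℕ => ((m * l ^ k : ℂˣ) : ℂ)) := by
    intro hi
    exact Set.infinite_range_of_injective hi hfin
  have hni' : ¬ Function.Injective (fun k : ℕ => l ^ k) := by
    intro hi
    apply hni
    intro i j hij
    apply hi
    exact mul_left_cancel (Units.ext hij)
  rw [injective_pow_iff_not_isOfFinOrder, not_not] at hni'
  exact isOfFinOrder_iff_pow_eq_one.1 hni'

theorem stmt6 (A₁ A₂ : SL2C)
    (htr1 : (Matrix.trace ((A₁ : Matrix (Fin 2) (Fin 2) ℂ))).im = 0)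
    (htr2 : (Matrix.trace ((A₂ : Matrix (Fin 2) (Fin 2) ℂ))).im = 0)
    (htr12 : (Matrix.trace (((A₁ * A₂ : SL2C) : Matrix (Fin 2) (Fin 2) ℂ))).im = 0)
    (hper : ElemPeriodic A₁ A₂)
    (hE : E (chi A₁ A₂ 1).1 (chi A₁ A₂ 1).2.1 (chi A₁ A₂ 1).2.2 = 1)
    (hV : chi A₁ A₂ 1 ∉ ({(1, 1, 1), (-1, -1, 1), (-1, 1, -1), (1, -1, -1)} :
            Set (ℂ × ℂ × ℂ))) :
    -- (i) simultaneous lower-triangularization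
    (∃ P : GL (Fin 2) ℂ,
      ((P : Matrix (Fin 2) (Fin 2) ℂ) * (A₁ : Matrix (Fin 2) (Fin 2) ℂ) *
        ((P⁻¹ : GL (Fin 2) ℂ) : Matrix (Fin 2) (Fin 2) ℂ)) 0 1 = 0 ∧
      ((P : Matrix (Fin 2) (Fin 2) ℂ) * (A₂ : Matrix (Fin 2) (Fin 2) ℂ) *
        ((P⁻¹ : GL (Fin 2) ℂ) : Matrix (Fin 2) (Fin 2) ℂ)) 0 1 = 0)
    ∧
    -- (ii) some orbit point has a coordinate equal to 1
    (∃ α : MulAut (FreeGroup (Fin 2)),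
      (chi A₁ A₂ α).1 = 1 ∨ (chi A₁ A₂ α).2.1 = 1 ∨ (chi A₁ A₂ α).2.2 = 1) := by
  have hd1 := A₁.2
  have hd2 := A₂.2
  rw [Matrix.det_fin_two] at hd1 hd2
  have hE' := hE
  simp only [chi, E, rho, MulAut.one_apply, map_mul, FreeGroup.lift_apply_of, Matrix.cons_val_zero,
    Matrix.cons_val_one, Matrix.SpecialLinearGroup.coe_mul, Matrix.trace_fin_two,
    Matrix.mul_apply, Fin.sum_univ_two] at hE'
  obtain ⟨x, y, h0, hq1, hq2⟩ := common_root (A₁.1 0 1) (A₁.1 1 1 - A₁.1 0 0) (A₁.1 1 0)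
    (A₂.1 0 1) (A₂.1 1 1 - A₂.1 0 0) (A₂.1 1 0) (by
      clear hE hV htr1 htr2 htr12 hper
      generalize A₁.1 0 0 = a at *
      generalize A₁.1 0 1 = b at *
      generalize A₁.1 1 0 = c at *
      generalize A₁.1 1 1 = d at *
      generalize A₂.1 0 0 = a' at *
      generalize A₂.1 0 1 = b' at *
      generalize A₂.1 1 0 = c' at *
      generalize A₂.1 1 1 = d' at *
      linear_combination 4 * hE' + (a + d) ^ 2 * hd2 + (a' + d') ^ 2 * hd1
        - 4 * (a * d - b * c) * hd2 - 4 * hd1)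
  obtain ⟨l, hl1, hl2⟩ := par (u := x * A₁.1 0 0 + y * A₁.1 1 0)
    (w := x * A₁.1 0 1 + y * A₁.1 1 1) h0 (by linear_combination hq1)
  obtain ⟨m, hm1, hm2⟩ := par (u := x * A₂.1 0 0 + y * A₂.1 1 0)
    (w := x * A₂.1 0 1 + y * A₂.1 1 1) h0 (by linear_combination hq2)
  constructor
  · have key : ∃ z t : ℂ, x * t - y * z ≠ 0 := by
      rcases h0 with h0 | h0
      · exact ⟨0, 1, by simpa using h0⟩
      · exact ⟨1, 0, by simpa using h0⟩
    obtain ⟨z, t, hzt⟩ := key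
    refine ⟨Matrix.GeneralLinearGroup.mkOfDetNeZero !![x, y; z, t]
      (by rwa [Matrix.det_fin_two_of]), ?_, ?_⟩
    · exact low _ _ l rfl rfl hl1 hl2
    · exact low _ _ m rfl rfl hm1 hm2
  · have hl := eig_ne A₁ h0 hl1 hl2
    have hm := eig_ne A₂ h0 hm1 hm2
    let φ : F2 →* ℂˣ := FreeGroup.lift ![Units.mk0 l hl, Units.mk0 m hm]
    have hφ0 : φ (FreeGroup.of 0) = Units.mk0 l hl := by simp [φ]
    have hφ1 : φ (FreeGroup.of 1) = Units.mk0 m hm := by simp [φ]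
    have heig : ∀ w : F2, x * (rho A₁ A₂ w).1 0 0 + y * (rho A₁ A₂ w).1 1 0 = (φ w : ℂ) * x ∧
        x * (rho A₁ A₂ w).1 0 1 + y * (rho A₁ A₂ w).1 1 1 = (φ w : ℂ) * y := by
      intro w
      induction w using FreeGroup.induction_on with
      | C1 => simp
      | of i => fin_cases i <;> simp [rho, φ, hl1, hl2, hm1, hm2]
      | inv_of i ih =>
        obtain ⟨ih1, ih2⟩ := ih
        have hd := (rho A₁ A₂ (FreeGroup.of i)).2
        rw [Matrix.det_fin_two] at hd
        have hne := (φ (FreeGroup.of i)).ne_zero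
        rw [map_inv, map_inv, Matrix.SpecialLinearGroup.coe_inv, Matrix.adjugate_fin_two,
          Units.val_inv_eq_inv_val]
        simp only [Matrix.of_apply, Matrix.cons_val', Matrix.cons_val_zero, Matrix.cons_val_one,
          Matrix.cons_val_fin_one]
        generalize (φ (FreeGroup.of i) : ℂ) = c at *
        generalize (rho A₁ A₂ (FreeGroup.of i)).1 = M at *
        constructor
        · apply mul_left_cancel₀ hne
          rw [mul_inv_cancel_left₀ hne]
          linear_combination x * hd - M 1 1 * ih1 + M 1 0 * ih2
        · apply mul_left_cancel₀ hne
          rw [mul_inv_cancel_left₀ hne]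
          linear_combination y * hd + M 0 1 * ih1 - M 0 0 * ih2
      | mul u v hu hv =>
        obtain ⟨hu1, hu2⟩ := hu
        obtain ⟨hv1, hv2⟩ := hv
        simp only [map_mul, Matrix.SpecialLinearGroup.coe_mul, Matrix.mul_apply, Fin.sum_univ_two,
          Units.val_mul]
        constructor
        · linear_combination (rho A₁ A₂ v).1 0 0 * hu1 + (rho A₁ A₂ v).1 1 0 * hu2 + (φ u : ℂ) * hv1
        · linear_combination (rho A₁ A₂ v).1 0 1 * hu1 + (rho A₁ A₂ v).1 1 1 * hu2 + (φ u : ℂ) * hv2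
    have htr : ∀ w : F2, (φ w : ℂ) ^ 2 - (rho A₁ A₂ w).1.trace * (φ w : ℂ) + 1 = 0 :=
      fun w => trace_eig _ h0 (heig w).1 (heig w).2
    obtain ⟨n1, hn1, hp1⟩ := finite_order (Units.mk0 l hl) (Units.mk0 m hm)
      (fun k => (rho A₁ A₂ ((autU ^ k) (FreeGroup.of 1))).1.trace)
      (((hper autU).image (fun p => 2 * p.2.1)).subset (by
        rintro _ ⟨k, rfl⟩
        refine ⟨_, ⟨k, rfl⟩, ?_⟩
        simp only [chi]; ring))
      (by
        intro k
        have := htr ((autU ^ k) (FreeGroup.of 1))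
        rw [show φ ((autU ^ k) (FreeGroup.of 1)) = Units.mk0 m hm * Units.mk0 l hl ^ k by
          rw [(autU_pow k).2, map_mul, map_pow, hφ0, hφ1]] at this
        exact this)
    have hc : ∀ k : ℕ, ((autS * autU * autS⁻¹) ^ k) (FreeGroup.of 0) =
        FreeGroup.of 0 * FreeGroup.of 1 ^ k := by
      intro k
      rw [conj_pow]
      have : autS⁻¹ (FreeGroup.of 0) = FreeGroup.of 1 := by
        rw [MulAut.inv_apply, MulEquiv.symm_apply_eq]; simp
      simp [MulAut.mul_apply, this, (autU_pow k).2]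
    obtain ⟨n2, hn2, hp2⟩ := finite_order (Units.mk0 m hm) (Units.mk0 l hl)
      (fun k => (rho A₁ A₂ (((autS * autU * autS⁻¹) ^ k) (FreeGroup.of 0))).1.trace)
      (((hper (autS * autU * autS⁻¹)).image (fun p => 2 * p.1)).subset (by
        rintro _ ⟨k, rfl⟩
        refine ⟨_, ⟨k, rfl⟩, ?_⟩
        simp only [chi]; ring))
      (by
        intro k
        have := htr (((autS * autU * autS⁻¹) ^ k) (FreeGroup.of 0))
        rw [show φ (((autS * autU * autS⁻¹) ^ k) (FreeGroup.of 0)) =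
            Units.mk0 l hl * Units.mk0 m hm ^ k by
          rw [hc, map_mul, map_pow, hφ0, hφ1]] at this
        exact this)
    have hN : n1 * n2 ≠ 0 := by positivity
    have : NeZero (n1 * n2) := ⟨hN⟩
    have hζ := Complex.isPrimitiveRoot_exp _ hN
    have hζ0 := hζ.ne_zero hN
    obtain ⟨a, -, ha⟩ := hζ.eq_pow_of_pow_eq_one (ξ := l) (by
      have := congrArg Units.val hp1
      simp only [Units.val_pow_eq_pow_val, Units.val_mk0, Units.val_one] at this
      rw [pow_mul, this, one_pow])
    obtain ⟨b, -, hb⟩ := hζ.eq_pow_of_pow_eq_one (ξ := m) (by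
      have := congrArg Units.val hp2
      simp only [Units.val_pow_eq_pow_val, Units.val_mk0, Units.val_one] at this
      rw [mul_comm, pow_mul, this, one_pow])
    obtain ⟨α, hα⟩ := euclid (Units.mk0 _ hζ0) _ a b le_rfl φ
      (hφ0.trans (Units.ext ha.symm)) (hφ1.trans (Units.ext hb.symm))
    refine ⟨α, Or.inl ?_⟩
    have := htr (α (FreeGroup.of 0))
    rw [hα] at this
    simp only [chi]
    simp only [Units.val_one] at this
    linear_combination (-1/2) * this

end
end
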